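/- arXiv:2512.10645 — 2 statements merged into one kernel-verified Lean document; each statement's English description precedes it below -/
import Mathlib

section
/- Let H be a complex Hilbert space, let A, B be bounded self-adjoint operators on H and C a bounded operator on H. Let M be a closed subspace of H that is invariant under A, B, and C, such that the spectra σ(A|_{M^⊥}) and σ(B|_M) are disjoint and B|_M is a compact operator on M (note that M^⊥ is invariant under A and B since A and B are self-adjoint and leave M invariant, so A|_{M^⊥} and the self-adjoint operator B|_M are well defined). If D is a bounded operator on H satisfying AD − DB = C, then M is invariant under D. -/
noncomputable section

/-- The trace of a finite-rank bounded operator, computed as the trace of its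
restriction to its (invariant) range. -/
def opTrace {H : Type*} [NormedAddCommGroup H] [InnerProductSpace ℂ H]
    (T : H →L[ℂ] H) : ℂ :=
  LinearMap.trace ℂ (LinearMap.range (T : H →ₗ[ℂ] H))
    ((T : H →ₗ[ℂ] H).restrict (p := LinearMap.range (T : H →ₗ[ℂ] H))
      (q := LinearMap.range (T : H →ₗ[ℂ] H))
      (fun x _ => LinearMap.mem_range_self _ x))

/-- A bounded operator has finite rank if its range is finite-dimensional. -/
def FinRk {H : Type*} [NormedAddCommGroup H] [InnerProductSpace ℂ H]
    (T : H →L[ℂ] H) : Prop :=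
  FiniteDimensional ℂ (LinearMap.range (T : H →ₗ[ℂ] H))

/-- `IsProjFR T` means that `T` is a finite-rank projection:
a self-adjoint idempotent bounded operator with finite-dimensional range. -/
def IsProjFR {H : Type*} [NormedAddCommGroup H] [InnerProductSpace ℂ H] [CompleteSpace H]
    (T : H →L[ℂ] H) : Prop :=
  IsSelfAdjoint T ∧ T ∘L T = T ∧ FinRk T

/-- `IsProjR T k` means that `T` is a projection of rank `k`. -/
def IsProjR {H : Type*} [NormedAddCommGroup H] [InnerProductSpace ℂ H] [CompleteSpace H]
    (T : H →L[ℂ] H) (k : ℕ) : Prop :=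
  IsProjFR T ∧ Module.finrank ℂ (LinearMap.range (T : H →ₗ[ℂ] H)) = k

/-- The real vector space `F_s(H)` of finite-rank bounded self-adjoint operators on `H`. -/
def FsS (H : Type*) [NormedAddCommGroup H] [InnerProductSpace ℂ H] [CompleteSpace H] :
    Submodule ℝ (H →L[ℂ] H) where
  carrier := {T | IsSelfAdjoint T ∧ FinRk T}
  add_mem' := by
    rintro S T ⟨hS, hSf⟩ ⟨hT, hTf⟩
    refine ⟨hS.add hT, ?_⟩
    haveI : FiniteDimensional ℂ (LinearMap.range (S : H →ₗ[ℂ] H)) := hSf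
    haveI : FiniteDimensional ℂ (LinearMap.range (T : H →ₗ[ℂ] H)) := hTf
    have hle : LinearMap.range ((S + T : H →L[ℂ] H) : H →ₗ[ℂ] H) ≤
        LinearMap.range (S : H →ₗ[ℂ] H) ⊔ LinearMap.range (T : H →ₗ[ℂ] H) := by
      rintro x ⟨y, rfl⟩
      exact Submodule.add_mem_sup (LinearMap.mem_range_self _ y) (LinearMap.mem_range_self _ y)
    exact Submodule.finiteDimensional_of_le hle
  zero_mem' := by
    refine ⟨(IsSelfAdjoint.zero _), ?_⟩
    have : LinearMap.range ((0 : H →L[ℂ] H) : H →ₗ[ℂ] H) = ⊥ := LinearMap.range_eq_bot.2 rfl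
    rw [FinRk, this]
    infer_instance
  smul_mem' := by
    rintro r T ⟨hT, hTf⟩
    refine ⟨(IsSelfAdjoint.all r).smul hT, ?_⟩
    haveI : FiniteDimensional ℂ (LinearMap.range (T : H →ₗ[ℂ] H)) := hTf
    have hle : LinearMap.range ((r • T : H →L[ℂ] H) : H →ₗ[ℂ] H) ≤
        LinearMap.range (T : H →ₗ[ℂ] H) := by
      rintro x ⟨y, rfl⟩
      show (r • T) y ∈ _
      rw [ContinuousLinearMap.smul_apply]
      exact Submodule.smul_of_tower_mem _ r (LinearMap.mem_range_self _ y)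
    exact Submodule.finiteDimensional_of_le hle

/-- The real vector space `S(H)` of bounded self-adjoint operators on `H`. -/
def SaS (H : Type*) [NormedAddCommGroup H] [InnerProductSpace ℂ H] [CompleteSpace H] :
    Submodule ℝ (H →L[ℂ] H) where
  carrier := {T | IsSelfAdjoint T}
  add_mem' := fun hS hT => hS.add hT
  zero_mem' := (IsSelfAdjoint.zero _)
  smul_mem' := fun r _T hT => (IsSelfAdjoint.all r).smul hT

/-- `IsConjBy U A B` expresses that `B = U A U*` for an isometry `U` (linear or
conjugate-linear): `B` agrees with `U ∘ A` on the image of `U` and vanishes on its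
orthogonal complement. -/
def IsConjBy {H K : Type*} [NormedAddCommGroup H] [InnerProductSpace ℂ H]
    [NormedAddCommGroup K] [InnerProductSpace ℂ K]
    (U : H → K) (A : H →L[ℂ] H) (B : K →L[ℂ] K) : Prop :=
  (∀ x : H, B (U x) = U (A x)) ∧
  ∀ y : K, (∀ x : H, (inner ℂ (U x) y : ℂ) = 0) → B y = 0

/-- The orthogonal projection onto a subspace, as an operator `H →L[ℂ] H`
(defined to be `0` if the subspace is not finite-dimensional). -/
def Pj {H : Type*} [NormedAddCommGroup H] [InnerProductSpace ℂ H]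
    (X : Submodule ℂ H) : H →L[ℂ] H := by
  classical
  exact if h : FiniteDimensional ℂ X then
    haveI := h
    haveI : CompleteSpace X := FiniteDimensional.complete ℂ X
    X.subtypeL ∘L Submodule.orthogonalProjection X
  else 0

/-- The set `H_a(X, Y)` of all finite-dimensional subspaces `Z` such that
`a(P_X + P_Y) + (1 - 2a) P_Z` is a projection. -/
def Hol {H : Type*} [NormedAddCommGroup H] [InnerProductSpace ℂ H] [CompleteSpace H]
    (a : ℝ) (X Y : Submodule ℂ H) : Set (Submodule ℂ H) :=
  {Z | FiniteDimensional ℂ Z ∧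
    IsSelfAdjoint (a • (Pj X + Pj Y) + (1 - 2*a) • Pj Z) ∧
    (a • (Pj X + Pj Y) + (1 - 2*a) • Pj Z) ∘L (a • (Pj X + Pj Y) + (1 - 2*a) • Pj Z) =
      a • (Pj X + Pj Y) + (1 - 2*a) • Pj Z}

/-- The matrix of an operator `T` with respect to an orthonormal basis `b` of a
(`T`-invariant) finite-dimensional subspace `Z`. -/
def matOf {H : Type*} [NormedAddCommGroup H] [InnerProductSpace ℂ H]
    {Z : Submodule ℂ H} {N : ℕ} (b : OrthonormalBasis (Fin N) ℂ Z) (T : H →L[ℂ] H) :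
    Matrix (Fin N) (Fin N) ℂ :=
  Matrix.of fun i j => (inner ℂ ((b i : H)) (T (b j : H)) : ℂ)

/-- Restriction of a bounded operator to an invariant subspace. -/
def clmRestrict {H : Type*} [NormedAddCommGroup H] [InnerProductSpace ℂ H]
    (T : H →L[ℂ] H) (M : Submodule ℂ H) (h : ∀ x ∈ M, T x ∈ M) : M →L[ℂ] M :=
  ContinuousLinearMap.codRestrict (T ∘L M.subtypeL) M (fun x => h x x.2)

end

theorem stmt6_aux {E : Type*} [NormedAddCommGroup E] [InnerProductSpace ℂ E]
    (T : E →L[ℂ] E) (μ : ℂ) (x : E) (hx : T x = μ • x) (hμ : μ ∉ spectrum ℂ T) : x = 0 := by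
  rw [spectrum.notMem_iff] at hμ
  obtain ⟨u, hu⟩ := hμ
  have h1 : (u : E →L[ℂ] E) x = 0 := by
    rw [hu, ContinuousLinearMap.sub_apply, hx, Algebra.algebraMap_eq_smul_one]
    simp
  have h2 : ((↑u⁻¹ : E →L[ℂ] E) * (u : E →L[ℂ] E)) x = x := by
    rw [Units.inv_mul]; rfl
  rw [← h2, ContinuousLinearMap.mul_apply, h1, map_zero]

/-- Lemma `abinv`, on the Sylvester equation. -/
theorem stmt6 {H : Type*} [NormedAddCommGroup H] [InnerProductSpace ℂ H] [CompleteSpace H]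
    (A B C D : H →L[ℂ] H) (hA : IsSelfAdjoint A) (hB : IsSelfAdjoint B)
    (M : Submodule ℂ H) (hM : IsClosed (M : Set H))
    (hMA : ∀ x ∈ M, A x ∈ M) (hMB : ∀ x ∈ M, B x ∈ M) (hMC : ∀ x ∈ M, C x ∈ M)
    (hspec : spectrum ℂ (clmRestrict A Mᗮ (fun x hx => by
        rw [Submodule.mem_orthogonal] at hx ⊢
        intro u hu
        exact (hA.isSymmetric u x).symm.trans (hx (A u) (hMA u hu)))) ∩
      spectrum ℂ (clmRestrict B M hMB) = ∅)
    (hcpt : IsCompactOperator ⇑(clmRestrict B M hMB))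
    (hSyl : A ∘L D - D ∘L B = C) :
    ∀ x ∈ M, D x ∈ M := by
  haveI : CompleteSpace M := hM.completeSpace_coe
  have hsym : (clmRestrict B M hMB).IsSymmetric := fun x y => hB.isSymmetric (x : H) (y : H)
  have hbot := ContinuousLinearMap.orthogonalComplement_iSup_eigenspaces_eq_bot hcpt hsym
  rw [← Submodule.topologicalClosure_eq_top_iff] at hbot
  have hAperp : ∀ x ∈ Mᗮ, A x ∈ Mᗮ := by
    intro x hx
    rw [Submodule.mem_orthogonal] at hx ⊢
    intro u hu
    exact (hA.isSymmetric u x).symm.trans (hx (A u) (hMA u hu))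
  have key : (⨆ μ, Module.End.eigenspace
      ((clmRestrict B M hMB : M →L[ℂ] M) : Module.End ℂ M) μ) ≤
      M.comap ((D : H →ₗ[ℂ] H) ∘ₗ M.subtype) := by
    refine iSup_le fun μ x hx => ?_
    rw [Module.End.mem_eigenspace_iff] at hx
    have hx' : clmRestrict B M hMB x = μ • x := hx
    show D (x : H) ∈ M
    by_cases hμ : μ ∈ spectrum ℂ (clmRestrict B M hMB)
    · have hμA : μ ∉ spectrum ℂ (clmRestrict A Mᗮ hAperp) := fun h => by
        have : μ ∈ (∅ : Set ℂ) := hspec ▸ ⟨h, hμ⟩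
        exact this
      have hBx : B (x : H) = μ • (x : H) := congrArg Subtype.val hx'
      have hC : A (D x) - μ • D x ∈ M := by
        have h := hMC x x.2
        rw [← hSyl] at h
        simpa [hBx] using h
      obtain ⟨p, hp, q, hq, hpq⟩ := Submodule.exists_add_mem_mem_orthogonal (K := M) (D (x : H))
      have h1 : A q - μ • q ∈ M := by
        have h2 : A p - μ • p ∈ M := M.sub_mem (hMA p hp) (M.smul_mem μ hp)
        have h3 := M.sub_mem hC h2
        rw [hpq, map_add, smul_add] at h3
        convert h3 using 1
        abel
      have h2 : A q - μ • q ∈ Mᗮ := Mᗮ.sub_mem (hAperp q hq) (Mᗮ.smul_mem μ hq)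
      have h3 : A q - μ • q = 0 := by
        have : A q - μ • q ∈ M ⊓ Mᗮ := ⟨h1, h2⟩
        rwa [Submodule.inf_orthogonal_eq_bot, Submodule.mem_bot] at this
      have h4 := stmt6_aux (clmRestrict A Mᗮ hAperp) μ ⟨q, hq⟩
        (Subtype.ext (sub_eq_zero.mp h3)) hμA
      have h5 : q = 0 := congrArg Subtype.val h4
      rw [hpq, h5, add_zero]
      exact hp
    · rw [stmt6_aux _ μ x hx' hμ]
      simp
  have hcl : IsClosed ((M.comap ((D : H →ₗ[ℂ] H) ∘ₗ M.subtype) : Submodule ℂ M) : Set M) :=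
    hM.preimage (D.continuous.comp continuous_subtype_val)
  intro x hx
  have := Submodule.topologicalClosure_minimal _ key hcl
  rw [hbot] at this
  exact this (Submodule.mem_top (x := (⟨x, hx⟩ : M)))
end

section
/- Let k ∈ ℕ, let K be a complex Hilbert space, and let φ : ℋ_{2k} → F_s(K) be a real-linear map such that φ(𝒫_{2k,k}) ⊆ 𝒫_f(K). Then there exist: m, p, r ∈ ℕ ∪ {0}; real numbers 1/2 < t_1 < … < t_r < 1; m_1, …, m_r ∈ ℕ; a real-linear map φ₀ : ℋ_{2k} → ℋ_{2p} with φ₀(I_{2k}) = I_{2p} and φ₀(I(ℋ_{2k}^0)) ⊆ I(ℋ_{2p}^0); real-linear maps φ_j : ℋ_{2k}^0 → M_{m_j} with φ_j(I(ℋ_{2k}^0)) ⊆ 𝒰_{m_j} for j = 1, …, r; a finite-dimensional subspace Z of K and an orthonormal basis B of Z, such that for every A ∈ ℋ_{2k}: the range of φ(A) is contained in Z, and the matrix of φ(A)|_Z with respect to B equals ((tr A / k)·I_m) ⊕ φ₀(A) ⊕ ⊕_{j=1}^r [[t_j·(tr A / k)·I_{m_j}, √(t_j(1−t_j))·φ_j(2A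 − (tr A / k)·I_{2k})*], [√(t_j(1−t_j))·φ_j(2A − (tr A / k)·I_{2k}), (1−t_j)·(tr A / k)·I_{m_j}]]. -/
open Matrix Kronecker

/-- `Mat m` is the space of `m × m` complex matrices. -/
abbrev Mat (m : ℕ) : Type := Matrix (Fin m) (Fin m) ℂ

/-- The "real part" `(A + A*)/2` of a square complex matrix. -/
noncomputable def MRe {m : ℕ} (A : Mat m) : Mat m := (2⁻¹ : ℂ) • (A + Aᴴ)

/-- The real vector space `ℋ_m` of `m × m` complex hermitian matrices,
as a real submodule of `Mat m`. -/
noncomputable def HermS (m : ℕ) : Submodule ℝ (Mat m) where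
  carrier := {A | A.IsHermitian}
  add_mem' := fun ha hb => ha.add hb
  zero_mem' := Matrix.isHermitian_zero
  smul_mem' := fun r A hA => by
    simpa [Matrix.IsHermitian, Matrix.conjTranspose_smul] using congrArg (r • ·) hA

/-- The real vector space `ℋ_m^0` of trace-zero `m × m` complex hermitian matrices,
as a real submodule of `Mat m`. -/
noncomputable def H0S (m : ℕ) : Submodule ℝ (Mat m) where
  carrier := {A | A.IsHermitian ∧ A.trace = 0}
  add_mem' := fun ha hb => ⟨ha.1.add hb.1, by simp [Matrix.trace_add, ha.2, hb.2]⟩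
  zero_mem' := ⟨Matrix.isHermitian_zero, by simp⟩
  smul_mem' := fun r A hA => ⟨by
    simpa [Matrix.IsHermitian, Matrix.conjTranspose_smul] using congrArg (r • ·) hA.1,
    by simp [Matrix.trace_smul, hA.2]⟩

/-- Transport a square matrix along an equality of sizes. -/
def castM {a b : ℕ} (h : a = b) (A : Mat a) : Mat b :=
  Matrix.reindex (finCongr h) (finCongr h) A

/-- A `2 × 2` block matrix with blocks of sizes `a` and `b`. -/
def blks {a b : ℕ} (A : Matrix (Fin a) (Fin a) ℂ) (B : Matrix (Fin a) (Fin b) ℂ)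
    (C : Matrix (Fin b) (Fin a) ℂ) (D : Matrix (Fin b) (Fin b) ℂ) : Mat (a + b) :=
  Matrix.reindex finSumFinEquiv finSumFinEquiv (Matrix.fromBlocks A B C D)

/-- The direct (block-diagonal) sum `A ⊕ B` of square matrices. -/
def dsum {a b : ℕ} (A : Mat a) (B : Mat b) : Mat (a + b) := blks A 0 0 B

/-- The Kronecker product of complex matrices, with `Fin`-indexing. -/
def kron {a b c d : ℕ} (A : Matrix (Fin a) (Fin b) ℂ) (B : Matrix (Fin c) (Fin d) ℂ) :
    Matrix (Fin (a * c)) (Fin (b * d)) ℂ :=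
  Matrix.reindex finProdFinEquiv finProdFinEquiv (A ⊗ₖ B)

/-- Iterated direct (block-diagonal) sum `A 0 ⊕ A 1 ⊕ ⋯ ⊕ A (r-1)` of square matrices
of sizes `m 0, …, m (r-1)`. -/
def bdiag : {r : ℕ} → (m : Fin r → ℕ) → ((j : Fin r) → Mat (m j)) → Mat (∑ j, m j)
  | 0, _, _ => 0
  | _+1, m, A =>
      castM (Fin.sum_univ_succ m).symm
        (dsum (A 0) (bdiag (fun j => m j.succ) (fun j => A j.succ)))



namespace S18

/-- good traceless hermitian unitaries -/
def Good {n : ℕ} (V : Mat n) : Prop :=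
  V.IsHermitian ∧ V.trace = 0 ∧ V * V = 1 ∧
    ∃ W : Mat n, W.IsHermitian ∧ W.trace = 0 ∧ W * W = 1 ∧ V * W = - (W * V)

lemma good_conj {n : ℕ} {V : Mat n} (hV : Good V) (U : Mat n) (h1 : Uᴴ * U = 1) :
    Good (U * V * Uᴴ) := by
  obtain ⟨a, b, c, W, a', b', c', d⟩ := hV
  have key : ∀ X Y : Mat n, (U * X * Uᴴ) * (U * Y * Uᴴ) = U * (X * Y) * Uᴴ := by
    intro X Y
    calc _ = U * X * (Uᴴ * U) * Y * Uᴴ := by simp only [Matrix.mul_assoc]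
      _ = _ := by rw [h1]; simp only [Matrix.mul_assoc, Matrix.one_mul]
  have h2 : U * Uᴴ = 1 := mul_eq_one_comm.mp h1
  have tr : ∀ X : Mat n, (U * X * Uᴴ).trace = X.trace := by
    intro X
    rw [Matrix.trace_mul_comm, ← Matrix.mul_assoc, h1, Matrix.one_mul]
  have he : ∀ X : Mat n, X.IsHermitian → (U * X * Uᴴ).IsHermitian := by
    intro X hX
    simp only [Matrix.IsHermitian, Matrix.conjTranspose_mul, Matrix.conjTranspose_conjTranspose,
      hX.eq, Matrix.mul_assoc]
  refine ⟨he _ a, (tr _).trans b, ?_, U * W * Uᴴ, he _ a', (tr _).trans b', ?_, ?_⟩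
  · rw [key, c, Matrix.mul_one, h2]
  · rw [key, c', Matrix.mul_one, h2]
  · rw [key, key, d]; simp

lemma good_diag {n : ℕ} (ε : Fin n → ℝ) (σ : Fin n → Fin n) (h1 : ∀ i, ε i * ε i = 1)
    (h2 : ∀ i, σ (σ i) = i) (h3 : ∀ i, ε (σ i) = - ε i) :
    Good (Matrix.diagonal (fun i => (ε i : ℂ))) := by
  have hne : ∀ i, σ i ≠ i := by
    intro i hi
    have := h3 i
    rw [hi] at this
    have h4 := h1 i
    have : ε i = 0 := by linarith
    simp [this] at h4
  have hs : Function.Bijective σ := ⟨fun a b h => by rw [← h2 a, h, h2], fun a => ⟨σ a, h2 a⟩⟩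
  refine ⟨?_, ?_, ?_, Matrix.of (fun i j => if σ i = j then 1 else 0), ?_, ?_, ?_, ?_⟩
  · ext i j
    by_cases h : i = j
    · subst h; simp
    · simp [Matrix.conjTranspose_apply, Matrix.diagonal_apply, h, Ne.symm h]
  · rw [Matrix.trace_diagonal, ← Complex.ofReal_sum]
    have : ∑ i, ε i = ∑ i, ε (σ i) := (hs.sum_comp ε).symm
    rw [Finset.sum_congr rfl (fun i _ => h3 i), Finset.sum_neg_distrib] at this
    have : ∑ i, ε i = 0 := by linarith
    simp [this]
  · rw [Matrix.diagonal_mul_diagonal, ← Matrix.diagonal_one]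
    congr 1; ext i
    exact_mod_cast h1 i
  · ext i j
    have : σ j = i ↔ σ i = j := ⟨fun h => by rw [← h, h2], fun h => by rw [← h, h2]⟩
    simp [Matrix.conjTranspose_apply, this]
  · simp [Matrix.trace, hne]
  · ext i j
    simp only [Matrix.mul_apply, Matrix.one_apply, Matrix.of_apply, ite_mul, one_mul, zero_mul,
      Finset.sum_ite_eq, Finset.mem_univ, if_true, h2]
  · ext i j
    simp only [Matrix.diagonal_mul, Matrix.of_apply, Matrix.neg_apply, Matrix.mul_diagonal]
    split_ifs with h
    · subst h; simp [h3]
    · simp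

lemma exists_signs (k : ℕ) (hk : 0 < k) (i j : Fin (2 * k)) (hij : i ≠ j) :
    ∃ (ε ε' : Fin (2 * k) → ℝ) (σ : Fin (2 * k) → Fin (2 * k)),
      (∀ i, ε i * ε i = 1) ∧ (∀ i, ε' i * ε' i = 1) ∧ (∀ i, σ (σ i) = i) ∧
      (∀ i, ε (σ i) = - ε i) ∧ (∀ i, ε' (σ i) = - ε' i) ∧
      ∀ x, ε x - ε' x = 2 * ((if x = i then 1 else 0) - (if x = j then 1 else 0)) := by
  classical
  have : NeZero k := ⟨hk.ne'⟩
  let e0 : Fin (2 * k) ≃ Fin k × Bool :=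
    ((finProdFinEquiv (m := 2) (n := k)).symm.trans (Equiv.prodComm _ _)).trans
      (Equiv.prodCongr (Equiv.refl _) finTwoEquiv)
  let e1 := e0.trans (Equiv.swap (e0 i) (0, true))
  have h1i : e1 i = (0, true) := by simp [e1]
  let e := e1.trans (Equiv.swap (e1 j) (0, false))
  have hei : e i = (0, true) := by
    simp only [e, Equiv.trans_apply, h1i]
    apply Equiv.swap_apply_of_ne_of_ne
    · rw [← h1i]; exact fun h => hij (e1.injective h)
    · simp
  have hej : e j = (0, false) := by simp [e]
  refine ⟨fun x => if (e x).2 then 1 else -1,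
    fun x => if (e x).1 = 0 then -(if (e x).2 then 1 else -1) else (if (e x).2 then 1 else -1),
    fun x => e.symm ((e x).1, !(e x).2), ?_, ?_, ?_, ?_, ?_, ?_⟩
  · intro x; dsimp only; split_ifs <;> norm_num
  · intro x; dsimp only; split_ifs <;> norm_num
  · intro x; simp
  · intro x; simp only [Equiv.apply_symm_apply]; cases (e x).2 <;> simp
  · intro x; simp only [Equiv.apply_symm_apply]; cases (e x).2 <;> by_cases h : (e x).1 = 0 <;> simp [h]
  · intro x
    have hxi : x = i ↔ e x = (0, true) := by rw [← hei]; exact e.injective.eq_iff.symm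
    have hxj : x = j ↔ e x = (0, false) := by rw [← hej]; exact e.injective.eq_iff.symm
    simp only [hxi, hxj]
    rcases e x with ⟨a, b⟩
    cases b <;> by_cases h : a = 0 <;> simp [h] <;> norm_num

lemma herm_mem_span (k : ℕ) (hk : 0 < k) (A : Mat (2 * k)) (hA : A.IsHermitian)
    (htr : A.trace = 0) : A ∈ Submodule.span ℝ {V : Mat (2 * k) | Good V} := by
  classical
  have hsp := hA.spectral_theorem
  set U : Mat (2 * k) := (hA.eigenvectorUnitary : Mat (2 * k)) with hU
  have hUU : Uᴴ * U = 1 := by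
    have := Matrix.mem_unitaryGroup_iff'.mp hA.eigenvectorUnitary.2
    simpa [Matrix.star_eq_conjTranspose] using this
  set a : Fin (2 * k) → ℝ := hA.eigenvalues
  have hAe : A = U * Matrix.diagonal (fun i => (a i : ℂ)) * Uᴴ := by
    conv_lhs => rw [hsp]
    rw [Unitary.conjStarAlgAut_apply]
    rfl
  have hsum : ∑ i, a i = 0 := by
    have h := htr
    rw [hAe, Matrix.trace_mul_comm, ← Matrix.mul_assoc, hUU, Matrix.one_mul,
      Matrix.trace_diagonal] at h
    exact_mod_cast h
  let L : (Fin (2 * k) → ℝ) →ₗ[ℝ] Mat (2 * k) :=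
    { toFun := fun f => U * Matrix.diagonal (fun i => (f i : ℂ)) * Uᴴ
      map_add' := by
        intro f g
        rw [← Matrix.add_mul, ← Matrix.mul_add, Matrix.diagonal_add]
        simp
      map_smul' := by
        intro c f
        have : (Matrix.diagonal (fun i => (((c • f) i : ℝ) : ℂ)) : Mat (2 * k)) =
          c • Matrix.diagonal (fun i => (f i : ℂ)) := by
          ext i j
          by_cases h : i = j <;> simp [Matrix.diagonal_apply, h]
        rw [this]; simp }
  have hpair : ∀ i j, i ≠ j → L (Pi.single i 1 - Pi.single j 1) ∈
      Submodule.span ℝ {V : Mat (2 * k) | Good V} := by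
    intro i j hij
    obtain ⟨ε, ε', σ, h1, h1', h2, h3, h3', h4⟩ := exists_signs k hk i j hij
    have : (Pi.single i 1 - Pi.single j 1 : Fin (2 * k) → ℝ) = (2⁻¹ : ℝ) • (ε - ε') := by
      ext x
      simp only [Pi.sub_apply, Pi.smul_apply, h4, Pi.single_apply, smul_eq_mul]
      ring
    rw [this, map_smul, map_sub]
    refine Submodule.smul_mem _ _ (Submodule.sub_mem _ (Submodule.subset_span ?_)
      (Submodule.subset_span ?_))
    · exact good_conj (good_diag ε σ h1 h2 h3) U hUU
    · exact good_conj (good_diag ε' σ h1' h2 h3') U hUU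
  have i0 : Fin (2 * k) := ⟨0, by omega⟩
  have ha : a = ∑ i, a i • (Pi.single i 1 - Pi.single i0 1 : Fin (2 * k) → ℝ) := by
    simp only [smul_sub, Finset.sum_sub_distrib, ← Finset.sum_smul, hsum, zero_smul, sub_zero]
    ext x
    simp [Finset.sum_apply, Pi.single_apply]
  have : A = L a := hAe
  rw [this, ha, map_sum]
  refine Submodule.sum_mem _ fun i _ => ?_
  rw [map_smul]
  refine Submodule.smul_mem _ _ ?_
  by_cases h : i = i0
  · subst h; simp
  · exact hpair _ _ h

lemma exists_good (k : ℕ) (hk : 0 < k) : ∃ V : Mat (2 * k), Good V := by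
  obtain ⟨ε, ε', σ, h1, h1', h2, h3, h3', h4⟩ :=
    exists_signs k hk ⟨0, by omega⟩ ⟨1, by omega⟩ (by simp [Fin.ext_iff])
  exact ⟨_, good_diag ε σ h1 h2 h3⟩

lemma H0S_induction (k : ℕ) (hk : 0 < k) (P : Submodule ℝ (H0S (2 * k)))
    (hP : ∀ V : H0S (2 * k), Good (V : Mat (2 * k)) → V ∈ P) (A : H0S (2 * k)) : A ∈ P := by
  have h := herm_mem_span k hk A A.2.1 A.2.2
  have h2 : Submodule.span ℝ {V : Mat (2 * k) | Good V} ≤ P.map (H0S (2 * k)).subtype := by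
    rw [Submodule.span_le]
    intro V hV
    exact ⟨⟨V, hV.1, hV.2.1⟩, hP _ hV, rfl⟩
  obtain ⟨B, hB, hBA⟩ := h2 h
  have : B = A := Subtype.ext hBA
  rwa [← this]

lemma rank_of_idem {n : ℕ} (P : Mat n) (h : P * P = P) : (P.rank : ℂ) = P.trace := by
  have hi : IsIdempotentElem (Matrix.toLin' P) := by
    rw [IsIdempotentElem, Module.End.mul_eq_comp, ← Matrix.toLin'_mul, h]
  have := LinearMap.IsProj.trace (LinearMap.IsIdempotentElem.isProj_range _ hi)
  rw [Matrix.trace_toLin'_eq] at this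
  rw [this]; rfl

end S18

namespace S18

lemma dsum_apply_aux {a b : ℕ} (A : Mat a) (B : Mat b) :
    dsum A B = (Matrix.fromBlocks A 0 0 B).submatrix finSumFinEquiv.symm finSumFinEquiv.symm := rfl

/-- splitting off the first element of a sigma type -/
def sigEquiv {r : ℕ} (m : Fin (r + 1) → ℕ) :
    (Σ j, Fin (m j)) ≃ Fin (m 0) ⊕ (Σ j : Fin r, Fin (m j.succ)) where
  toFun x := Fin.cases (motive := fun j => Fin (m j) → Fin (m 0) ⊕ (Σ j : Fin r, Fin (m j.succ)))
    (fun a => Sum.inl a) (fun j a => Sum.inr ⟨j, a⟩) x.1 x.2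
  invFun := Sum.elim (fun a => ⟨0, a⟩) (fun y => ⟨y.1.succ, y.2⟩)
  left_inv := by
    rintro ⟨j, a⟩
    cases j using Fin.cases <;> simp
  right_inv := by
    rintro (a | ⟨j, a⟩) <;> simp

lemma bdiag_equiv : ∀ {r : ℕ} (m : Fin r → ℕ),
    ∃ e : (Σ j, Fin (m j)) ≃ Fin (∑ j, m j), ∀ A : (j : Fin r) → Mat (m j),
      ∀ x y, bdiag m A (e x) (e y) = Matrix.blockDiagonal' A x y
  | 0, m => ⟨Equiv.equivOfIsEmpty (α := (Σ j, Fin (m j))) (β := Fin 0),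
      fun A x => x.1.elim0⟩
  | r + 1, m => by
    obtain ⟨e, he⟩ := bdiag_equiv (fun j => m j.succ)
    refine ⟨(sigEquiv m).trans (((Equiv.sumCongr (Equiv.refl _) e).trans finSumFinEquiv).trans
      (finCongr (Fin.sum_univ_succ m).symm)), ?_⟩
    intro A x y
    simp only [bdiag, castM, dsum, blks, Matrix.reindex_apply, Matrix.submatrix_apply,
      Equiv.trans_apply, Equiv.symm_apply_apply]
    rcases x with ⟨j, a⟩
    rcases y with ⟨j', a'⟩
    cases j using Fin.cases <;> cases j' using Fin.cases
    · simp [sigEquiv, Matrix.blockDiagonal'_apply]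
    · simp [sigEquiv, Matrix.blockDiagonal'_apply, (Fin.succ_ne_zero _).symm]
    · simp [sigEquiv, Matrix.blockDiagonal'_apply]
    · rename_i j j'
      simp only [sigEquiv, Equiv.coe_fn_mk, Fin.cases_succ, Equiv.sumCongr_apply, Sum.map_inr,
        Matrix.fromBlocks_apply₂₂, he]
      by_cases h : j = j'
      · subst h; simp [Matrix.blockDiagonal'_apply]
      · simp [Matrix.blockDiagonal'_apply, h]

lemma full_equiv (m p r : ℕ) (mj : Fin r → ℕ) :
    ∃ E : ((Fin m ⊕ Fin p) ⊕ (Σ j, (Fin (mj j) ⊕ Fin (mj j)))) ≃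
        Fin (m + p + ∑ j, (mj j + mj j)),
      ∀ (A0 : Mat m) (A1 : Mat p) (B11 B12 B21 B22 : ∀ j, Mat (mj j)), ∀ x y,
        dsum (dsum A0 A1) (bdiag (fun j => mj j + mj j)
          fun j => blks (B11 j) (B12 j) (B21 j) (B22 j)) (E x) (E y) =
        Matrix.fromBlocks (Matrix.fromBlocks A0 0 0 A1) 0 0
          (Matrix.blockDiagonal' fun j => Matrix.fromBlocks (B11 j) (B12 j) (B21 j) (B22 j)) x y := by
  obtain ⟨e, he⟩ := bdiag_equiv (fun j => mj j + mj j)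
  refine ⟨(Equiv.sumCongr finSumFinEquiv
    ((Equiv.sigmaCongrRight fun j => finSumFinEquiv).trans e)).trans finSumFinEquiv, ?_⟩
  intro A0 A1 B11 B12 B21 B22 x y
  rw [dsum_apply_aux, Matrix.submatrix_apply]
  simp only [Equiv.trans_apply, Equiv.symm_apply_apply]
  rcases x with x | x <;> rcases y with y | y
  · simp [dsum_apply_aux]
  · simp
  · simp
  · rcases x with ⟨j, x⟩
    rcases y with ⟨j', y⟩
    simp only [Equiv.sumCongr_apply, Sum.map_inr, Equiv.trans_apply, Matrix.fromBlocks_apply₂₂, he]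
    by_cases h : j = j'
    · subst h
      simp [Matrix.blockDiagonal'_apply, blks]
    · simp [Matrix.blockDiagonal'_apply, h]

end S18

namespace S18

variable {K : Type*} [NormedAddCommGroup K] [InnerProductSpace ℂ K]

/-- the algebraic system extracted from the map -/
structure Sys (k : ℕ) (C : K →L[ℂ] K) (T : H0S (2 * k) →ₗ[ℝ] (K →L[ℂ] K)) : Prop where
  kpos : 0 < k
  saC : ∀ x y, (inner ℂ (C x) y : ℂ) = inner ℂ x (C y)
  finC : FiniteDimensional ℂ (LinearMap.range (C : K →ₗ[ℂ] K))
  saT : ∀ A x y, (inner ℂ (T A x) y : ℂ) = inner ℂ x (T A y)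
  anti : ∀ V : H0S (2 * k), (V : Mat (2 * k)) * V = 1 →
    ∀ x, T V (C x) + C (T V x) = (2 : ℂ) • T V x
  sq : ∀ V : H0S (2 * k), (V : Mat (2 * k)) * V = 1 →
    ∀ x, T V (T V x) = (2 : ℂ) • C x - C (C x)

/-- orthonormal basis of the eigenspace -/
structure IsONB (C : K →L[ℂ] K) (l : ℝ) {d : ℕ} (u : Fin d → K) : Prop where
  on : Orthonormal ℂ u
  eig : ∀ i, C (u i) = (l : ℂ) • u i
  expand : ∀ x, C x = (l : ℂ) • x → x = ∑ i, (inner ℂ (u i) x : ℂ) • u i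

variable {k : ℕ} {C : K →L[ℂ] K} {T : H0S (2 * k) →ₗ[ℝ] (K →L[ℂ] K)}

lemma Sys.anti' (h : Sys k C T) (A : H0S (2 * k)) (x : K) :
    T A (C x) + C (T A x) = (2 : ℂ) • T A x := by
  let P : Submodule ℝ (H0S (2 * k)) :=
    { carrier := {A | ∀ x, T A (C x) + C (T A x) = (2 : ℂ) • T A x}
      add_mem' := by
        intro a b ha hb x
        simp only [map_add, ContinuousLinearMap.add_apply, smul_add, ← ha x, ← hb x]
        abel
      zero_mem' := by intro x; simp
      smul_mem' := by
        intro c a ha x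
        have := ha x
        simp only [map_smul, _root_.smul_apply]
        rw [smul_comm (2 : ℂ) c, ← this, smul_add]
        congr 1
        exact (C : K →ₗ[ℂ] K).map_smul_of_tower c _ }
  exact H0S_induction k h.kpos P (fun V hV => h.anti V hV.2.2.1) A x

lemma Sys.eig (h : Sys k C T) (A : H0S (2 * k)) {x : K} {l : ℝ} (hx : C x = (l : ℂ) • x) :
    C (T A x) = ((2 - l : ℝ) : ℂ) • T A x := by
  have := h.anti' A x
  rw [hx, map_smul] at this
  push_cast
  rw [sub_smul, ← this]
  abel

lemma Sys.sq' (h : Sys k C T) (V : H0S (2 * k)) (hV : (V : Mat (2 * k)) * V = 1)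
    {x : K} {l : ℝ} (hx : C x = (l : ℂ) • x) :
    T V (T V x) = ((l * (2 - l) : ℝ) : ℂ) • x := by
  rw [h.sq V hV, hx, map_smul, hx, smul_smul, smul_smul, ← sub_smul]
  congr 1
  push_cast; ring

lemma Sys.normsq (h : Sys k C T) (V : H0S (2 * k)) (hV : (V : Mat (2 * k)) * V = 1)
    {x : K} {l : ℝ} (hx : C x = (l : ℂ) • x) :
    ‖T V x‖ ^ 2 = l * (2 - l) * ‖x‖ ^ 2 := by
  have h1 : (inner ℂ (T V x) (T V x) : ℂ) = ((l * (2 - l) : ℝ) : ℂ) * inner ℂ x x := by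
    rw [h.saT, h.sq' V hV hx, inner_smul_right]
  rw [inner_self_eq_norm_sq_to_K, inner_self_eq_norm_sq_to_K] at h1
  have h2 : ((‖T V x‖ ^ 2 : ℝ) : ℂ) = ((l * (2 - l) * ‖x‖ ^ 2 : ℝ) : ℂ) := by
    push_cast
    push_cast at h1
    exact h1
  exact Complex.ofReal_injective h2

lemma Sys.kill (h : Sys k C T) (A : H0S (2 * k)) {x : K} {l : ℝ} (hx : C x = (l : ℂ) • x)
    (hl : l * (2 - l) = 0) : T A x = 0 := by
  let P : Submodule ℝ (H0S (2 * k)) :=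
    { carrier := {A | T A x = 0}
      add_mem' := by
        intro a b (ha : T a x = 0) (hb : T b x = 0)
        show T (a + b) x = 0
        simp [ha, hb]
      zero_mem' := by show T 0 x = 0; simp
      smul_mem' := by
        intro c a (ha : T a x = 0)
        show T (c • a) x = 0
        simp [ha] }
  refine H0S_induction k h.kpos P (fun V hV => ?_) A
  have := h.normsq V hV.2.2.1 hx
  rw [hl, zero_mul] at this
  exact norm_eq_zero.mp (pow_eq_zero_iff (two_ne_zero) |>.mp this)

lemma Sys.symC (h : Sys k C T) : (C : K →ₗ[ℂ] K).IsSymmetric := fun x y => h.saC x y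

lemma Sys.range_mem (h : Sys k C T) (A : H0S (2 * k)) (x : K) :
    T A x ∈ LinearMap.range (C : K →ₗ[ℂ] K) := by
  have := h.finC
  rw [← Submodule.orthogonal_orthogonal (LinearMap.range (C : K →ₗ[ℂ] K)),
    h.symC.orthogonal_range, Submodule.mem_orthogonal]
  intro y hy
  have hy' : C y = ((0 : ℝ) : ℂ) • y := by simpa using hy
  rw [← h.saT, h.kill A hy' (by ring), inner_zero_left]

lemma Sys.exists_V (h : Sys k C T) : ∃ V : H0S (2 * k), Good (V : Mat (2 * k)) := by
  obtain ⟨V, hV⟩ := exists_good k h.kpos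
  exact ⟨⟨V, hV.1, hV.2.1⟩, hV⟩

lemma Sys.eig_mem (h : Sys k C T) {x : K} {l : ℝ} (hx : C x = (l : ℂ) • x) (hx0 : x ≠ 0) :
    0 ≤ l ∧ l ≤ 2 := by
  obtain ⟨V, hV⟩ := h.exists_V
  have h1 := h.normsq V hV.2.2.1 hx
  have h2 : 0 < ‖x‖ ^ 2 := by positivity
  have h3 : 0 ≤ l * (2 - l) := by
    by_contra hc
    push Not at hc
    nlinarith [sq_nonneg ‖T V x‖]
  constructor <;> nlinarith

lemma Sys.orth (h : Sys k C T) {x y : K} {l l' : ℝ} (hx : C x = (l : ℂ) • x)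
    (hy : C y = (l' : ℂ) • y) (hl : l ≠ l') : (inner ℂ x y : ℂ) = 0 := by
  have := h.saC x y
  rw [hx, hy, inner_smul_left, inner_smul_right, Complex.conj_ofReal] at this
  have h2 : ((l : ℂ) - l') * inner ℂ x y = 0 := by rw [sub_mul, this, sub_self]
  rcases mul_eq_zero.mp h2 with h3 | h3
  · exact absurd (by exact_mod_cast sub_eq_zero.mp h3) hl
  · exact h3

/-- eigenspace -/
def Eg (C : K →L[ℂ] K) (l : ℝ) : Submodule ℂ K := Module.End.eigenspace (C : K →ₗ[ℂ] K) (l : ℂ)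

lemma mem_Eg {l : ℝ} {x : K} : x ∈ Eg C l ↔ C x = (l : ℂ) • x := Module.End.mem_eigenspace_iff

lemma Sys.fin_Eg (h : Sys k C T) {l : ℝ} (hl : l ≠ 0) : FiniteDimensional ℂ (Eg C l) := by
  have := h.finC
  have hle : Eg C l ≤ LinearMap.range (C : K →ₗ[ℂ] K) := by
    intro x hx
    rw [mem_Eg] at hx
    refine ⟨(l : ℂ)⁻¹ • x, ?_⟩
    have hl' : (l : ℂ) ≠ 0 := by exact_mod_cast hl
    show C ((l : ℂ)⁻¹ • x) = x
    rw [map_smul, hx, smul_smul, inv_mul_cancel₀ hl', one_smul]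
  exact Submodule.finiteDimensional_of_le hle

lemma Sys.exists_onb (h : Sys k C T) {l : ℝ} (hl : l ≠ 0) {d : ℕ}
    (hd : Module.finrank ℂ (Eg C l) = d) : ∃ u : Fin d → K, IsONB C l u := by
  have := h.fin_Eg hl
  subst hd
  let b := stdOrthonormalBasis ℂ (Eg C l)
  refine ⟨fun i => (b i : K), ?_, fun i => mem_Eg.mp (b i).2, fun x hx => ?_⟩
  · exact b.orthonormal.comp_linearIsometry (Eg C l).subtypeₗᵢ
  · have h1 := b.sum_repr' ⟨x, mem_Eg.mpr hx⟩
    have h2 := congrArg (Subtype.val) h1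
    simpa using h2.symm

lemma Sys.finrank_le (h : Sys k C T) {l : ℝ} (hl0 : 0 < l) (hl2 : l < 2) :
    Module.finrank ℂ (Eg C l) ≤ Module.finrank ℂ (Eg C (2 - l)) := by
  obtain ⟨V, hV⟩ := h.exists_V
  have := h.fin_Eg (l := 2 - l) (by linarith)
  let f : Eg C l →ₗ[ℂ] Eg C (2 - l) := (T V : K →ₗ[ℂ] K).restrict (by
    intro x hx
    exact mem_Eg.mpr (h.eig V (mem_Eg.mp hx)))
  refine LinearMap.finrank_le_finrank_of_injective (f := f) ?_
  rw [← LinearMap.ker_eq_bot, LinearMap.ker_eq_bot']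
  rintro ⟨x, hx⟩ hf
  have h1 : T V x = 0 := congrArg Subtype.val hf
  have h2 := h.normsq V hV.2.2.1 (mem_Eg.mp hx)
  rw [h1] at h2
  have h3 : l * (2 - l) ≠ 0 := by apply ne_of_gt; apply mul_pos <;> linarith
  have h4 : ‖x‖ ^ 2 = 0 := by
    rcases mul_eq_zero.mp (show l * (2 - l) * ‖x‖ ^ 2 = 0 by rw [← h2]; simp) with h | h
    · exact absurd h h3
    · exact h
  ext
  simpa using h4

lemma Sys.finrank_eq (h : Sys k C T) {l : ℝ} (hl0 : 0 < l) (hl2 : l < 2) :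
    Module.finrank ℂ (Eg C (2 - l)) = Module.finrank ℂ (Eg C l) := by
  apply le_antisymm _ (h.finrank_le hl0 hl2)
  have := h.finrank_le (l := 2 - l) (by linarith) (by linarith)
  rwa [sub_sub_cancel] at this

/-- matrix of `S` between two families -/
noncomputable def mm {d : ℕ} (w u : Fin d → K) (S : K →L[ℂ] K) : Mat d :=
  Matrix.of fun b a => (inner ℂ (w b) (S (u a)) : ℂ)

lemma Sys.mm_sq (h : Sys k C T) {l : ℝ} {d : ℕ} {u w : Fin d → K} (hu : IsONB C l u)
    (hw : IsONB C (2 - l) w) (V : H0S (2 * k)) (hV : (V : Mat (2 * k)) * V = 1) :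
    (mm w u (T V))ᴴ * mm w u (T V) = ((l * (2 - l) : ℝ) : ℂ) • 1 := by
  ext a a'
  have h1 := hw.expand _ (h.eig V (hu.eig a'))
  have h2 : (inner ℂ (T V (u a)) (T V (u a')) : ℂ) =
      ((l * (2 - l) : ℝ) : ℂ) * inner ℂ (u a) (u a') := by
    rw [h.saT, h.sq' V hV (hu.eig a'), inner_smul_right]
  rw [orthonormal_iff_ite.mp hu.on] at h2
  rw [Matrix.smul_apply, Matrix.one_apply, smul_eq_mul, ← h2, Matrix.mul_apply]
  conv_rhs => rw [h1]
  rw [inner_sum]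
  refine Finset.sum_congr rfl fun b _ => ?_
  rw [inner_smul_right, mul_comm, Matrix.conjTranspose_apply]
  simp only [mm, Matrix.of_apply]
  congr 1
  exact inner_conj_symm _ _

lemma mm_add {d : ℕ} (w u : Fin d → K) (S S' : K →L[ℂ] K) :
    mm w u (S + S') = mm w u S + mm w u S' := by
  ext; simp [mm, inner_add_right]

lemma mm_smul {d : ℕ} (w u : Fin d → K) (c : ℝ) (S : K →L[ℂ] K) :
    mm w u (c • S) = c • mm w u S := by
  ext
  simp only [mm, Matrix.of_apply, _root_.smul_apply, Matrix.smul_apply]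
  exact inner_smul_right_eq_smul _ _ _

end S18

namespace S18

variable {K : Type*} [NormedAddCommGroup K] [InnerProductSpace ℂ K]
variable {k : ℕ} {C : K →L[ℂ] K} {T : H0S (2 * k) →ₗ[ℝ] (K →L[ℂ] K)}

lemma Sys.mm_herm (h : Sys k C T) {d : ℕ} (u : Fin d → K) (A : H0S (2 * k)) :
    (mm u u (T A))ᴴ = mm u u (T A) := by
  ext a b
  simp only [mm, Matrix.conjTranspose_apply, Matrix.of_apply]
  rw [← h.saT]
  exact inner_conj_symm _ _

lemma Sys.mm_sq1 (h : Sys k C T) {d : ℕ} {u : Fin d → K} (hu : IsONB C 1 u)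
    (V : H0S (2 * k)) (hV : (V : Mat (2 * k)) * V = 1) :
    mm u u (T V) * mm u u (T V) = 1 := by
  have hu' : IsONB C (2 - 1) u := by norm_num; exact hu
  have := h.mm_sq hu hu' V hV
  rw [h.mm_herm] at this
  rw [this]; norm_num

lemma Sys.mm_anti (h : Sys k C T) {d : ℕ} {u : Fin d → K} (hu : IsONB C 1 u)
    (V W : H0S (2 * k)) (hV : (V : Mat (2 * k)) * V = 1) (hW : (W : Mat (2 * k)) * W = 1)
    (hVW : (V : Mat (2 * k)) * W = - (W * V)) :
    mm u u (T V) * mm u u (T W) = - (mm u u (T W) * mm u u (T V)) := by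
  set c : ℝ := (Real.sqrt 2)⁻¹ with hc
  have hcc : c * c = 2⁻¹ := by
    rw [hc, ← mul_inv, Real.mul_self_sqrt (by norm_num)]
  have hX : ((c • (V + W) : H0S (2 * k)) : Mat (2 * k)) * (c • (V + W) : H0S (2 * k)) = 1 := by
    show (c • ((V : Mat (2 * k)) + W)) * (c • ((V : Mat (2 * k)) + W)) = 1
    rw [smul_mul_smul_comm, hcc, add_mul, mul_add, mul_add, hV, hW, hVW]
    rw [show (1 + -((W : Mat (2 * k)) * V) + (W * V + 1) : Mat (2 * k)) = (2 : ℝ) • 1 by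
      rw [two_smul]; abel]
    rw [smul_smul]; norm_num
  have h1 := h.mm_sq1 hu _ hX
  rw [map_smul, map_add, mm_smul, mm_add, smul_mul_smul_comm, hcc, add_mul, mul_add, mul_add,
    h.mm_sq1 hu V hV, h.mm_sq1 hu W hW] at h1
  have h2 := congrArg ((2 : ℝ) • ·) h1
  simp only [smul_smul] at h2
  norm_num at h2
  rw [two_smul] at h2
  rw [eq_neg_iff_add_eq_zero]
  have h3 : mm u u (T V) * mm u u (T W) + mm u u (T W) * mm u u (T V) =
    (1 + mm u u (T V) * mm u u (T W) + (mm u u (T W) * mm u u (T V) + 1)) - (1 + 1) := by abel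
  rw [h3, h2, sub_self]

lemma Sys.mm_even (h : Sys k C T) {d : ℕ} {u : Fin d → K} (hu : IsONB C 1 u) : Even d := by
  obtain ⟨V, h1, h2, hV, W, h1', h2', hW, hVW⟩ := h.exists_V
  let W' : H0S (2 * k) := ⟨W, h1', h2'⟩
  have ha := h.mm_anti hu V W' hV hW hVW
  have d1 := congrArg Matrix.det (h.mm_sq1 hu V hV)
  have d2 := congrArg Matrix.det (h.mm_sq1 hu W' hW)
  have d3 := congrArg Matrix.det ha
  rw [Matrix.det_neg, Matrix.det_mul, Matrix.det_mul, Fintype.card_fin] at d3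
  rw [Matrix.det_mul, Matrix.det_one] at d1 d2
  by_contra hd
  rw [Nat.not_even_iff_odd] at hd
  rw [hd.neg_one_pow] at d3
  set a := (mm u u (T V)).det
  set b := (mm u u (T W')).det
  have h0 : a * b = 0 := by linear_combination d3 / 2
  have : (1 : ℂ) = 0 := by
    calc (1 : ℂ) = (a * a) * (b * b) := by rw [d1, d2, one_mul]
      _ = (a * b) * (a * b) := by ring
      _ = 0 := by rw [h0, zero_mul]
  exact one_ne_zero this

lemma Sys.mm_trace (h : Sys k C T) {d : ℕ} {u : Fin d → K} (hu : IsONB C 1 u)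
    (A : H0S (2 * k)) : (mm u u (T A)).trace = 0 := by
  let P : Submodule ℝ (H0S (2 * k)) :=
    { carrier := {A | (mm u u (T A)).trace = 0}
      add_mem' := by
        intro a b (ha : (mm u u (T a)).trace = 0) (hb : (mm u u (T b)).trace = 0)
        show (mm u u (T (a + b))).trace = 0
        rw [map_add, mm_add, Matrix.trace_add, ha, hb, add_zero]
      zero_mem' := by
        show (mm u u (T 0)).trace = 0
        rw [map_zero, ← zero_smul ℝ (0 : K →L[ℂ] K), mm_smul, zero_smul, Matrix.trace_zero]
      smul_mem' := by
        intro c a (ha : (mm u u (T a)).trace = 0)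
        show (mm u u (T (c • a))).trace = 0
        rw [map_smul, mm_smul, Matrix.trace_smul, ha, smul_zero] }
  refine H0S_induction k h.kpos P (fun V hV => ?_) A
  show (mm u u (T V)).trace = 0
  obtain ⟨h1, h2, hV, W, h1', h2', hW, hVW⟩ := hV
  let W' : H0S (2 * k) := ⟨W, h1', h2'⟩
  have ha := h.mm_anti hu V W' hV hW hVW
  have hw := h.mm_sq1 hu W' hW
  have e1 : (mm u u (T V)).trace = (mm u u (T V) * mm u u (T W') * mm u u (T W')).trace := by
    rw [Matrix.mul_assoc, hw, Matrix.mul_one]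
  have e2 : (mm u u (T V) * mm u u (T W') * mm u u (T W')).trace = - (mm u u (T V)).trace := by
    rw [ha, Matrix.neg_mul, Matrix.trace_neg, Matrix.mul_assoc, Matrix.trace_mul_comm,
      Matrix.mul_assoc, hw, Matrix.mul_one]
  rw [e2] at e1
  exact self_eq_neg.mp e1

/-- the restriction of `C` to its range -/
def CR (C : K →L[ℂ] K) :
    LinearMap.range (C : K →ₗ[ℂ] K) →ₗ[ℂ] LinearMap.range (C : K →ₗ[ℂ] K) :=
  (C : K →ₗ[ℂ] K).restrict (fun x _ => LinearMap.mem_range_self _ x)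

lemma Sys.finite_ev (h : Sys k C T) :
    {l : ℝ | l ≠ 0 ∧ Eg C l ≠ ⊥}.Finite := by
  have := h.finC
  have hf : {μ : ℂ | Module.End.HasEigenvalue (CR C) μ}.Finite :=
    Module.End.finite_hasEigenvalue (CR C)
  refine (hf.preimage (f := fun l : ℝ => (l : ℂ)) Complex.ofReal_injective.injOn).subset ?_
  rintro l ⟨hl, hE⟩
  obtain ⟨x, hx, hx0⟩ := Submodule.exists_mem_ne_zero_of_ne_bot hE
  rw [mem_Eg] at hx
  have hl' : (l : ℂ) ≠ 0 := by exact_mod_cast hl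
  have hxr : x ∈ LinearMap.range (C : K →ₗ[ℂ] K) := by
    refine ⟨(l : ℂ)⁻¹ • x, ?_⟩
    show C ((l : ℂ)⁻¹ • x) = x
    rw [map_smul, hx, smul_smul, inv_mul_cancel₀ hl', one_smul]
  refine Module.End.hasEigenvalue_of_hasEigenvector (x := ⟨x, hxr⟩) ⟨?_, ?_⟩
  · rw [Module.End.mem_eigenspace_iff]
    exact Subtype.ext hx
  · intro h0; exact hx0 (congrArg Subtype.val h0)

lemma Sys.range_le (h : Sys k C T) (Z : Submodule ℂ K)
    (hZ : ∀ (l : ℝ) (x : K), l ≠ 0 → x ≠ 0 → C x = (l : ℂ) • x → x ∈ Z) :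
    LinearMap.range (C : K →ₗ[ℂ] K) ≤ Z := by
  have := h.finC
  have hs : (CR C).IsSymmetric := fun x y => h.saC x y
  have htop : (⨆ μ : ℂ, Module.End.eigenspace (CR C) μ) = ⊤ := by
    rw [← Submodule.orthogonal_eq_bot_iff]
    exact hs.orthogonalComplement_iSup_eigenspaces_eq_bot
  have hle : (⨆ μ : ℂ, Module.End.eigenspace (CR C) μ) ≤
      Z.comap (LinearMap.range (C : K →ₗ[ℂ] K)).subtype := by
    refine iSup_le fun μ x hx => ?_
    show (x : K) ∈ Z
    by_cases hx0 : x = 0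
    · rw [hx0]; exact Z.zero_mem
    have hev : Module.End.HasEigenvalue (CR C) μ :=
      Module.End.hasEigenvalue_of_hasEigenvector ⟨hx, hx0⟩
    have hre : ((μ.re : ℝ) : ℂ) = μ := Complex.conj_eq_iff_re.mp (hs.conj_eigenvalue_eq_self hev)
    have hxC : C (x : K) = ((μ.re : ℝ) : ℂ) • (x : K) := by
      rw [hre]
      exact congrArg Subtype.val (Module.End.mem_eigenspace_iff.mp hx)
    have hx0' : (x : K) ≠ 0 := fun h0 => hx0 (Subtype.ext h0)
    refine hZ μ.re x ?_ hx0' hxC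
    intro h0
    rw [h0] at hxC
    obtain ⟨y, hy⟩ := x.2
    apply hx0'
    have hCx : C (x : K) = 0 := by simpa using hxC
    rw [← inner_self_eq_zero (𝕜 := ℂ)]
    nth_rw 1 [← hy]
    show (inner ℂ (C y) (x : K) : ℂ) = 0
    rw [h.saC, hCx, inner_zero_right]
  intro x hx
  have : (⟨x, hx⟩ : LinearMap.range (C : K →ₗ[ℂ] K)) ∈ (⨆ μ : ℂ, Module.End.eigenspace (CR C) μ) := by
    rw [htop]; trivial
  exact hle this

lemma Sys.decomp (h : Sys k C T) : ∃ (m p r : ℕ) (t : Fin r → ℝ) (mj : Fin r → ℕ)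
    (u2 : Fin m → K) (u1 : Fin (2 * p) → K) (v w : (j : Fin r) → Fin (mj j) → K),
    (∀ j, 1 / 2 < t j ∧ t j < 1) ∧ StrictMono t ∧ (∀ j, 0 < mj j) ∧
    IsONB C 2 u2 ∧ IsONB C 1 u1 ∧ (∀ j, IsONB C (2 * t j) (v j)) ∧
    (∀ j, IsONB C (2 - 2 * t j) (w j)) ∧
    ∀ (l : ℝ) (x : K), l ≠ 0 → x ≠ 0 → C x = (l : ℂ) • x →
      l = 2 ∨ l = 1 ∨ ∃ j, l = 2 * t j ∨ l = 2 - 2 * t j := by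
  classical
  have hfin : {l : ℝ | (1 < l ∧ l < 2) ∧ Eg C l ≠ ⊥}.Finite :=
    h.finite_ev.subset fun l hl => ⟨by have := hl.1.1; linarith, hl.2⟩
  let s := hfin.toFinset
  have hs : ∀ l, l ∈ s ↔ (1 < l ∧ l < 2) ∧ Eg C l ≠ ⊥ := fun l => by simp [s]
  let f := s.orderEmbOfFin rfl
  have hf : ∀ j, f j ∈ s := fun j => s.orderEmbOfFin_mem rfl j
  have hf' := fun j => (hs _).mp (hf j)
  obtain ⟨u2, hu2⟩ := h.exists_onb (l := 2) (by norm_num) rfl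
  obtain ⟨u1', hu1'⟩ := h.exists_onb (l := 1) (by norm_num) rfl
  obtain ⟨p, hp⟩ := h.mm_even hu1'
  obtain ⟨u1, hu1⟩ := h.exists_onb (l := 1) (by norm_num) (hp.trans (two_mul p).symm)
  have hv : ∀ j, ∃ u : Fin (Module.finrank ℂ (Eg C (f j))) → K, IsONB C (f j) u := fun j =>
    h.exists_onb (by have := (hf' j).1.1; linarith) rfl
  have hw : ∀ j, ∃ u : Fin (Module.finrank ℂ (Eg C (f j))) → K, IsONB C (2 - f j) u := fun j =>
    h.exists_onb (by have := (hf' j).1.2; linarith)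
      (h.finrank_eq (by have := (hf' j).1.1; linarith) (hf' j).1.2)
  choose v hv using hv
  choose w hw using hw
  have h2 : ∀ j, 2 * (f j / 2) = f j := fun j => by ring
  refine ⟨_, p, s.card, fun j => f j / 2, fun j => Module.finrank ℂ (Eg C (f j)), u2, u1, v, w,
    ?_, ?_, ?_, hu2, hu1, ?_, ?_, ?_⟩
  · intro j
    have := (hf' j).1
    constructor <;> linarith [this.1, this.2]
  · intro i j hij
    have : f i < f j := f.strictMono hij
    show f i / 2 < f j / 2
    linarith
  · intro j
    have := h.fin_Eg (l := f j) (by have := (hf' j).1.1; linarith)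
    have h3 := (hf' j).2
    rw [Nat.pos_iff_ne_zero]
    intro h4
    exact h3 (Submodule.finrank_eq_zero.mp h4)
  · intro j; rw [h2]; exact hv j
  · intro j; rw [h2]; exact hw j
  · intro l x hl hx hCx
    simp only [h2]
    obtain ⟨l0, l2⟩ := h.eig_mem hCx hx
    have hsurj : ∀ l, l ∈ s → ∃ j, f j = l := by
      intro l hl
      have : l ∈ Set.range f := by rw [s.range_orderEmbOfFin rfl]; exact hl
      exact this
    have hEl : Eg C l ≠ ⊥ := (Submodule.ne_bot_iff _).mpr ⟨x, mem_Eg.mpr hCx, hx⟩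
    by_cases e2 : l = 2
    · exact Or.inl e2
    by_cases e1 : l = 1
    · exact Or.inr (Or.inl e1)
    have l0' : 0 < l := lt_of_le_of_ne l0 (Ne.symm hl)
    have l2' : l < 2 := lt_of_le_of_ne l2 e2
    right; right
    rcases lt_or_gt_of_ne e1 with hlt | hgt
    · obtain ⟨j, hj⟩ := hsurj (2 - l) ((hs _).mpr ⟨⟨by linarith, by linarith⟩, by
        have h5 := h.finrank_eq l0' l2'
        have := h.fin_Eg hl
        intro hb
        rw [hb, finrank_bot] at h5
        exact hEl (Submodule.finrank_eq_zero.mp h5.symm)⟩)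
      exact ⟨j, Or.inr (by rw [hj]; ring)⟩
    · obtain ⟨j, hj⟩ := hsurj l ((hs _).mpr ⟨⟨hgt, l2'⟩, hEl⟩)
      exact ⟨j, Or.inl hj.symm⟩

end S18

namespace S18

variable {K : Type*} [NormedAddCommGroup K] [InnerProductSpace ℂ K]

/-- the identity as a hermitian matrix -/
noncomputable def one' (n : ℕ) : HermS n := ⟨1, Matrix.isHermitian_one⟩

/-- inclusion -/
noncomputable def incl (n : ℕ) : H0S n →ₗ[ℝ] HermS n where
  toFun A := ⟨A, A.2.1⟩
  map_add' _ _ := rfl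
  map_smul' _ _ := rfl

lemma half_proj [CompleteSpace K] (k : ℕ) (φ : HermS (2 * k) →ₗ[ℝ] (K →L[ℂ] K))
    (hproj : ∀ A : HermS (2 * k),
      (A : Mat (2 * k)) * (A : Mat (2 * k)) = (A : Mat (2 * k)) →
      (A : Mat (2 * k)).rank = k → IsProjFR (φ A))
    (V : H0S (2 * k)) (hV : (V : Mat (2 * k)) * V = 1) (x : K) :
    φ (one' _) (φ (one' _) x) + φ (one' _) (φ (incl _ V) x) + φ (incl _ V) (φ (one' _) x)
      + φ (incl _ V) (φ (incl _ V) x) = (2 : ℂ) • (φ (one' _) x + φ (incl _ V) x) := by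
  let P : HermS (2 * k) := (2⁻¹ : ℝ) • (one' (2 * k) + incl _ V)
  have hPc : (P : Mat (2 * k)) = (2⁻¹ : ℝ) • (1 + (V : Mat (2 * k))) := rfl
  have hPP : (P : Mat (2 * k)) * P = P := by
    rw [hPc, smul_mul_smul_comm, add_mul, mul_add, mul_add, hV, Matrix.one_mul, Matrix.one_mul,
      Matrix.mul_one, show (1 + (V : Mat (2 * k)) + (V + 1) : Mat (2 * k)) =
        (2 : ℝ) • (1 + (V : Mat (2 * k))) by rw [two_smul]; abel, smul_smul]
    norm_num
  have hr : (P : Mat (2 * k)).rank = k := by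
    have := rank_of_idem _ hPP
    rw [hPc, Matrix.trace_smul, Matrix.trace_add, V.2.2, Matrix.trace_one, ← hPc,
      Fintype.card_fin] at this
    have h2 : (((P : Mat (2 * k)).rank : ℕ) : ℂ) = (k : ℂ) := by
      rw [this]; push_cast; rw [Complex.real_smul]; push_cast; ring
    exact_mod_cast h2
  have hid := congrArg (fun S : K →L[ℂ] K => S x) (hproj P hPP hr).2.1
  have hφP : ∀ y, φ P y = (2⁻¹ : ℂ) • (φ (one' _) y + φ (incl _ V) y) := by
    intro y
    show φ ((2⁻¹ : ℝ) • (one' (2 * k) + incl _ V)) y = _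
    rw [map_smul, map_add, _root_.smul_apply, _root_.add_apply,
      ← Complex.coe_smul]
    push_cast; rfl
  have hid' : φ P (φ P x) = φ P x := hid
  rw [hφP, hφP, map_smul, map_smul, map_add, map_add] at hid'
  have h4 := congrArg (fun z => (4 : ℂ) • z) hid'
  simp only [smul_add, smul_smul] at h4
  norm_num at h4
  rw [smul_add, ← h4]
  abel

lemma mkSys [CompleteSpace K] (k : ℕ) (hk : 0 < k) (φ : HermS (2 * k) →ₗ[ℝ] (K →L[ℂ] K))
    (hfs : ∀ A : HermS (2 * k), IsSelfAdjoint (φ A) ∧ FinRk (φ A))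
    (hproj : ∀ A : HermS (2 * k),
      (A : Mat (2 * k)) * (A : Mat (2 * k)) = (A : Mat (2 * k)) →
      (A : Mat (2 * k)).rank = k → IsProjFR (φ A)) :
    Sys k (φ (one' _)) (φ ∘ₗ incl _) := by
  have hsa : ∀ A x y, (inner ℂ (φ A x) y : ℂ) = inner ℂ x (φ A y) := fun A x y =>
    (hfs A).1.isSymmetric x y
  have key : ∀ V : H0S (2 * k), (V : Mat (2 * k)) * V = 1 → ∀ x,
      (φ (incl _ V) (φ (one' _) x) + φ (one' _) (φ (incl _ V) x) = (2 : ℂ) • φ (incl _ V) x) ∧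
      (φ (incl _ V) (φ (incl _ V) x) = (2 : ℂ) • φ (one' _) x - φ (one' _) (φ (one' _) x)) := by
    intro V hV x
    have h1 := half_proj k φ hproj V hV x
    have h2 := half_proj k φ hproj (-V) (by
      show (-(V : Mat (2 * k))) * (-(V : Mat (2 * k))) = 1
      rw [neg_mul_neg, hV]) x
    have hn : ∀ y, φ (incl _ (-V)) y = - φ (incl _ V) y := by
      intro y; rw [map_neg, map_neg]; rfl
    simp only [hn] at h2
    simp only [map_neg, neg_neg] at h2
    generalize φ (one' _) (φ (one' _) x) = a at *
    generalize φ (one' _) (φ (incl _ V) x) = b at *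
    generalize φ (incl _ V) (φ (one' _) x) = c at *
    generalize φ (incl _ V) (φ (incl _ V) x) = d at *
    generalize φ (one' _) x = e at *
    generalize φ (incl _ V) x = f at *
    constructor
    · linear_combination (norm := module) (2⁻¹ : ℂ) • h1 - (2⁻¹ : ℂ) • h2
    · linear_combination (norm := module) (2⁻¹ : ℂ) • h1 + (2⁻¹ : ℂ) • h2
  exact ⟨hk, hsa _, (hfs _).2, fun A => hsa _, fun V hV x => (key V hV x).1,
    fun V hV x => (key V hV x).2⟩

lemma entry {k : ℕ} (φ : HermS (2 * k) →ₗ[ℝ] (K →L[ℂ] K))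
    (A : HermS (2 * k)) (A₀ : H0S (2 * k))
    (hA : (A₀ : Mat (2 * k)) =
            (2 : ℂ) • (A : Mat (2 * k)) - (((A : Mat (2 * k)).trace / k) • 1)) (y : K) :
    φ A y = ((A : Mat (2 * k)).trace / k / 2) • φ (one' _) y + (2⁻¹ : ℂ) • φ (incl _ A₀) y := by
  have hre : (A : Mat (2 * k)).trace = (((A : Mat (2 * k)).trace.re : ℝ) : ℂ) := by
    symm
    apply Complex.conj_eq_iff_re.mp
    have h1 := Matrix.trace_conjTranspose (A : Mat (2 * k))
    have h2 : (A : Mat (2 * k))ᴴ = A := A.2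
    rw [h2] at h1
    exact h1.symm
  set τ : ℝ := (A : Mat (2 * k)).trace.re
  have hAe : A = (τ / k / 2) • one' (2 * k) + (2⁻¹ : ℝ) • incl _ A₀ := by
    apply Subtype.ext
    show (A : Mat (2 * k)) = (τ / k / 2) • (1 : Mat (2 * k)) + (2⁻¹ : ℝ) • (A₀ : Mat (2 * k))
    rw [hA, hre]
    ext i j
    simp only [Matrix.add_apply, Matrix.smul_apply, Matrix.sub_apply, Complex.real_smul,
      smul_eq_mul]
    push_cast
    ring
  conv_lhs => rw [hAe]
  rw [map_add, map_smul, map_smul, _root_.add_apply, _root_.smul_apply,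
    _root_.smul_apply, ← Complex.coe_smul, ← Complex.coe_smul, hre]
  push_cast
  rfl

end S18

namespace S18

variable {K : Type*} [NormedAddCommGroup K] [InnerProductSpace ℂ K]
variable {k : ℕ} {C : K →L[ℂ] K} {T : H0S (2 * k) →ₗ[ℝ] (K →L[ℂ] K)}

/-- all basis vectors -/
def vec {m p r : ℕ} {mj : Fin r → ℕ} (u2 : Fin m → K) (u1 : Fin p → K)
    (v w : (j : Fin r) → Fin (mj j) → K) :
    ((Fin m ⊕ Fin p) ⊕ (Σ j, (Fin (mj j) ⊕ Fin (mj j)))) → K :=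
  Sum.elim (Sum.elim u2 u1) (fun x => Sum.elim (v x.1) (w x.1) x.2)

/-- all eigenvalues -/
noncomputable def lam {m p r : ℕ} {mj : Fin r → ℕ} (t : Fin r → ℝ) :
    ((Fin m ⊕ Fin p) ⊕ (Σ j, (Fin (mj j) ⊕ Fin (mj j)))) → ℝ :=
  Sum.elim (Sum.elim (fun _ => 2) (fun _ => 1))
    (fun x => Sum.elim (fun _ => 2 * t x.1) (fun _ => 2 - 2 * t x.1) x.2)

lemma vec_eig {m p r : ℕ} {mj : Fin r → ℕ} {u2 : Fin m → K} {u1 : Fin p → K}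
    {v w : (j : Fin r) → Fin (mj j) → K} {t : Fin r → ℝ}
    (h2 : IsONB C 2 u2) (h1 : IsONB C 1 u1) (hv : ∀ j, IsONB C (2 * t j) (v j))
    (hw : ∀ j, IsONB C (2 - 2 * t j) (w j)) (i) :
    C (vec u2 u1 v w i) = ((lam t i : ℝ) : ℂ) • vec u2 u1 v w i := by
  rcases i with (i | i) | ⟨j, i | i⟩
  · exact h2.eig i
  · exact h1.eig i
  · exact (hv j).eig i
  · exact (hw j).eig i

lemma Sys.vec_on (h : Sys k C T) {m p r : ℕ} {mj : Fin r → ℕ} {u2 : Fin m → K} {u1 : Fin p → K}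
    {v w : (j : Fin r) → Fin (mj j) → K} {t : Fin r → ℝ}
    (ht : ∀ j, 1 / 2 < t j ∧ t j < 1) (hmono : StrictMono t)
    (h2 : IsONB C 2 u2) (h1 : IsONB C 1 u1) (hv : ∀ j, IsONB C (2 * t j) (v j))
    (hw : ∀ j, IsONB C (2 - 2 * t j) (w j)) : Orthonormal ℂ (vec u2 u1 v w) := by
  classical
  have hoff : ∀ i i', lam t i ≠ lam t i' →
      (inner ℂ (vec u2 u1 v w i) (vec u2 u1 v w i') : ℂ) = 0 := fun i i' hne =>
    h.orth (vec_eig h2 h1 hv hw i) (vec_eig h2 h1 hv hw i') hne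
  constructor
  · rintro ((i | i) | ⟨j, i | i⟩)
    · exact h2.on.1 i
    · exact h1.on.1 i
    · exact (hv j).on.1 i
    · exact (hw j).on.1 i
  · rintro ((i | i) | ⟨j, i | i⟩) ((i' | i') | ⟨j', i' | i'⟩) hne
    · exact h2.on.2 (by rintro rfl; exact hne rfl)
    · apply hoff; simp [lam]
    · apply hoff; simp only [lam, Sum.elim_inl, Sum.elim_inr]; intro hh; linarith [ht j']
    · apply hoff; simp only [lam, Sum.elim_inl, Sum.elim_inr]; intro hh; linarith [ht j']
    · apply hoff; simp [lam]
    · exact h1.on.2 (by rintro rfl; exact hne rfl)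
    · apply hoff; simp only [lam, Sum.elim_inl, Sum.elim_inr]; intro hh; linarith [ht j']
    · apply hoff; simp only [lam, Sum.elim_inl, Sum.elim_inr]; intro hh; linarith [ht j']
    · apply hoff; simp only [lam, Sum.elim_inl, Sum.elim_inr]; intro hh; linarith [ht j]
    · apply hoff; simp only [lam, Sum.elim_inl, Sum.elim_inr]; intro hh; linarith [ht j]
    · by_cases hj : j = j'
      · subst hj
        exact (hv j).on.2 (by rintro rfl; exact hne rfl)
      · apply hoff; simp only [lam, Sum.elim_inl, Sum.elim_inr]; intro hh
        exact hj (hmono.injective (by linarith))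
    · apply hoff; simp only [lam, Sum.elim_inl, Sum.elim_inr]; intro hh; linarith [ht j, ht j']
    · apply hoff; simp only [lam, Sum.elim_inl, Sum.elim_inr]; intro hh; linarith [ht j]
    · apply hoff; simp only [lam, Sum.elim_inl, Sum.elim_inr]; intro hh; linarith [ht j]
    · apply hoff; simp only [lam, Sum.elim_inl, Sum.elim_inr]; intro hh; linarith [ht j, ht j']
    · by_cases hj : j = j'
      · subst hj
        exact (hw j).on.2 (by rintro rfl; exact hne rfl)
      · apply hoff; simp only [lam, Sum.elim_inl, Sum.elim_inr]; intro hh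
        exact hj (hmono.injective (by linarith))

lemma IsONB.mem_span {l : ℝ} {d : ℕ} {u : Fin d → K} (hu : IsONB C l u) {x : K}
    (hx : C x = (l : ℂ) • x) {Z : Submodule ℂ K} (hZ : ∀ i, u i ∈ Z) : x ∈ Z := by
  rw [hu.expand x hx]
  exact Submodule.sum_mem _ fun i _ => Submodule.smul_mem _ _ (hZ i)

/-- an orthonormal family is an orthonormal basis of its span, reindexed -/
lemma exists_basis {ι : Type*} [Fintype ι] {N : ℕ} (e : ι ≃ Fin N) (x : ι → K)
    (hx : Orthonormal ℂ x) :
    ∃ b : OrthonormalBasis (Fin N) ℂ (Submodule.span ℂ (Set.range x)),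
      ∀ i, (b (e i) : K) = x i := by
  let y : ι → Submodule.span ℂ (Set.range x) := fun i => ⟨x i, Submodule.subset_span ⟨i, rfl⟩⟩
  have hy : Orthonormal ℂ y := by
    rw [← (Submodule.span ℂ (Set.range x)).subtypeₗᵢ.orthonormal_comp_iff]
    exact hx
  have hs : ⊤ ≤ Submodule.span ℂ (Set.range y) := by
    have hr : Set.range y = ((↑) : Submodule.span ℂ (Set.range x) → K) ⁻¹' Set.range x := by
      ext z
      constructor
      · rintro ⟨i, rfl⟩; exact ⟨i, rfl⟩
      · rintro ⟨i, hi⟩; exact ⟨i, Subtype.ext hi⟩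
    rw [hr, Submodule.span_span_coe_preimage]
  refine ⟨(OrthonormalBasis.mk hy hs).reindex e, fun i => ?_⟩
  simp [y]

lemma Sys.phij_unitary (h : Sys k C T) {t : ℝ} (ht : 1 / 2 < t ∧ t < 1) {d : ℕ} {v w : Fin d → K}
    (hv : IsONB C (2 * t) v) (hw : IsONB C (2 - 2 * t) w) (V : H0S (2 * k))
    (hV : (V : Mat (2 * k)) * V = 1) :
    (2 * Real.sqrt (t * (1 - t)))⁻¹ • mm w v (T V) ∈ Matrix.unitaryGroup (Fin d) ℂ := by
  rw [Matrix.mem_unitaryGroup_iff', Matrix.star_eq_conjTranspose, Matrix.conjTranspose_smul,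
    star_trivial, smul_mul_smul_comm, h.mm_sq hv hw V hV, ← Complex.coe_smul, smul_smul,
    ← Complex.ofReal_mul]
  have hpos : 0 < t * (1 - t) := mul_pos (by linarith) (by linarith)
  have hs : Real.sqrt (t * (1 - t)) * Real.sqrt (t * (1 - t)) = t * (1 - t) :=
    Real.mul_self_sqrt hpos.le
  have hs0 : Real.sqrt (t * (1 - t)) ≠ 0 := (Real.sqrt_pos.mpr hpos).ne'
  have : (2 * Real.sqrt (t * (1 - t)))⁻¹ * (2 * Real.sqrt (t * (1 - t)))⁻¹ *
      (2 * t * (2 - 2 * t)) = 1 := by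
    rw [← mul_inv, show 2 * Real.sqrt (t * (1 - t)) * (2 * Real.sqrt (t * (1 - t))) =
      4 * (Real.sqrt (t * (1 - t)) * Real.sqrt (t * (1 - t))) by ring, hs,
      show 2 * t * (2 - 2 * t) = 4 * (t * (1 - t)) by ring]
    exact inv_mul_cancel₀ (by positivity)
  rw [this]; simp

end S18

/-- Lemma `phraz`. -/
theorem stmt18 {K : Type*} [NormedAddCommGroup K] [InnerProductSpace ℂ K] [CompleteSpace K]
    (k : ℕ) (hk : 0 < k)
    (φ : HermS (2 * k) → (K →L[ℂ] K)) (hlin : IsLinearMap ℝ φ)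
    (hfs : ∀ A : HermS (2 * k), IsSelfAdjoint (φ A) ∧ FinRk (φ A))
    (hproj : ∀ A : HermS (2 * k),
      (A : Mat (2 * k)) * (A : Mat (2 * k)) = (A : Mat (2 * k)) →
      (A : Mat (2 * k)).rank = k → IsProjFR (φ A)) :
    ∃ (m p r : ℕ) (t : Fin r → ℝ) (mj : Fin r → ℕ),
      (∀ j, 1 / 2 < t j ∧ t j < 1) ∧ StrictMono t ∧ (∀ j, 0 < mj j) ∧
      ∃ φ₀ : HermS (2 * k) → HermS (2 * p),
        IsLinearMap ℝ φ₀ ∧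
        (∀ A : HermS (2 * k), (A : Mat (2 * k)) = 1 → (φ₀ A : Mat (2 * p)) = 1) ∧
        (∀ A : HermS (2 * k), (A : Mat (2 * k)).trace = 0 →
          (A : Mat (2 * k)) ∈ Matrix.unitaryGroup (Fin (2 * k)) ℂ →
          (φ₀ A : Mat (2 * p)).trace = 0 ∧
          (φ₀ A : Mat (2 * p)) ∈ Matrix.unitaryGroup (Fin (2 * p)) ℂ) ∧
      ∃ φj : (j : Fin r) → (H0S (2 * k) → Mat (mj j)),
        (∀ j, IsLinearMap ℝ (φj j)) ∧
        (∀ j, ∀ A : H0S (2 * k),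
          (A : Mat (2 * k)) ∈ Matrix.unitaryGroup (Fin (2 * k)) ℂ →
          φj j A ∈ Matrix.unitaryGroup (Fin (mj j)) ℂ) ∧
      ∃ (Z : Submodule ℂ K) (_ : FiniteDimensional ℂ Z)
        (b : OrthonormalBasis (Fin (m + 2 * p + ∑ j, (mj j + mj j))) ℂ Z),
        (∀ (A : HermS (2 * k)) (x : K), φ A x ∈ Z) ∧
        ∀ (A : HermS (2 * k)) (A₀ : H0S (2 * k)),
          (A₀ : Mat (2 * k)) =
            (2 : ℂ) • (A : Mat (2 * k)) - (((A : Mat (2 * k)).trace / k) • 1) →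
          matOf b (φ A) =
            dsum (dsum ((((A : Mat (2 * k)).trace / k) • 1 : Mat m)) (φ₀ A : Mat (2 * p)))
              (bdiag (fun j => mj j + mj j) fun j =>
                blks ((((t j : ℝ) : ℂ) * ((A : Mat (2 * k)).trace / k)) • (1 : Mat (mj j)))
                  ((Real.sqrt (t j * (1 - t j)) : ℂ) • (φj j A₀)ᴴ)
                  ((Real.sqrt (t j * (1 - t j)) : ℂ) • (φj j A₀))
                  ((((1 - t j : ℝ) : ℂ) * ((A : Mat (2 * k)).trace / k)) • (1 : Mat (mj j)))) := by
  let Φ : HermS (2 * k) →ₗ[ℝ] (K →L[ℂ] K) := IsLinearMap.mk' φ hlin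
  have hΦ : ∀ A, Φ A = φ A := fun A => rfl
  have h := S18.mkSys k hk Φ hfs hproj
  set C := Φ (S18.one' _) with hC
  obtain ⟨m, p, r, t, mj, u2, u1, v, w, ht, hmono, hmj, h2, h1, hv, hw, hall⟩ := h.decomp
  have hon := h.vec_on ht hmono h2 h1 hv hw
  obtain ⟨E, hE⟩ := S18.full_equiv m (2 * p) r mj
  obtain ⟨b, hb⟩ := S18.exists_basis E _ hon
  have hsa : ∀ A x y, (inner ℂ (φ A x) y : ℂ) = inner ℂ x (φ A y) := fun A x y =>
    (hfs A).1.isSymmetric x y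
  have huni : ∀ V : H0S (2 * k), (V : Mat (2 * k)) ∈ Matrix.unitaryGroup (Fin (2 * k)) ℂ →
      (V : Mat (2 * k)) * V = 1 := by
    intro V hV
    have := Matrix.mem_unitaryGroup_iff.mp hV
    rwa [Matrix.star_eq_conjTranspose, V.2.1.eq] at this
  let Z : Submodule ℂ K := Submodule.span ℂ (Set.range (S18.vec u2 u1 v w))
  have hvecZ : ∀ i, S18.vec u2 u1 v w i ∈ Z := fun i => Submodule.subset_span ⟨i, rfl⟩
  have hrange : LinearMap.range (C : K →ₗ[ℂ] K) ≤ Z := by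
    apply h.range_le
    intro l x hl hx0 hx
    rcases hall l x hl hx0 hx with rfl | rfl | ⟨j, rfl | rfl⟩
    · exact h2.mem_span hx fun i => hvecZ (Sum.inl (Sum.inl i))
    · exact h1.mem_span hx fun i => hvecZ (Sum.inl (Sum.inr i))
    · exact (hv j).mem_span hx fun i => hvecZ (Sum.inr ⟨j, Sum.inl i⟩)
    · exact (hw j).mem_span hx fun i => hvecZ (Sum.inr ⟨j, Sum.inr i⟩)
  have hherm : ∀ A, (S18.mm u1 u1 (φ A)).IsHermitian := by
    intro A
    ext a c
    simp only [S18.mm, Matrix.conjTranspose_apply, Matrix.of_apply]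
    rw [← hsa]
    exact inner_conj_symm _ _
  refine ⟨m, p, r, t, mj, ht, hmono, hmj, fun A => ⟨S18.mm u1 u1 (φ A), hherm A⟩, ?_, ?_, ?_,
    fun j A => (2 * Real.sqrt (t j * (1 - t j)))⁻¹ • S18.mm (w j) (v j) (Φ (S18.incl _ A)),
    ?_, ?_, Z, ?_, b, ?_, ?_⟩
  · constructor
    · intro A B
      apply Subtype.ext
      show S18.mm u1 u1 (φ (A + B)) = S18.mm u1 u1 (φ A) + S18.mm u1 u1 (φ B)
      rw [hlin.map_add, S18.mm_add]
    · intro c A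
      apply Subtype.ext
      show S18.mm u1 u1 (φ (c • A)) = c • S18.mm u1 u1 (φ A)
      rw [hlin.map_smul, S18.mm_smul]
  · intro A hA
    have : A = S18.one' _ := Subtype.ext hA
    subst this
    ext a c
    show (inner ℂ (u1 a) (C (u1 c)) : ℂ) = _
    rw [h1.eig, inner_smul_right, orthonormal_iff_ite.mp h1.on, Matrix.one_apply]
    simp
  · intro A htr hA
    let V : H0S (2 * k) := ⟨A, A.2, htr⟩
    refine ⟨h.mm_trace h1 V, ?_⟩
    rw [Matrix.mem_unitaryGroup_iff, Matrix.star_eq_conjTranspose]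
    show S18.mm u1 u1 (φ A) * (S18.mm u1 u1 (φ A))ᴴ = 1
    rw [(hherm A).eq]
    exact h.mm_sq1 h1 V (huni V hA)
  · intro j
    constructor
    · intro A B
      show _ • _ = _ • _ + _ • _
      rw [map_add, map_add, S18.mm_add, smul_add]
    · intro c A
      show _ • _ = c • _ • _
      rw [map_smul, map_smul, S18.mm_smul, smul_comm]
  · intro j A hA
    exact h.phij_unitary (ht j) (hv j) (hw j) A (huni A hA)
  · exact FiniteDimensional.span_of_finite ℂ (Set.finite_range _)
  · intro A x
    have hmem : ((2 : ℂ) • (A : Mat (2 * k)) - (((A : Mat (2 * k)).trace / k) • 1)) ∈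
        H0S (2 * k) := by
      have hAh : (A : Mat (2 * k))ᴴ = A := A.2
      have hst : star (A : Mat (2 * k)).trace = (A : Mat (2 * k)).trace := by
        rw [← Matrix.trace_conjTranspose, hAh]
      constructor
      · rw [Matrix.IsHermitian, Matrix.conjTranspose_sub, Matrix.conjTranspose_smul,
          Matrix.conjTranspose_smul, hAh, Matrix.conjTranspose_one, star_div₀, hst]
        simp
      · have hk0 : (k : ℂ) ≠ 0 := by exact_mod_cast hk.ne'
        rw [Matrix.trace_sub, Matrix.trace_smul, Matrix.trace_smul, Matrix.trace_one,
          Fintype.card_fin]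
        simp only [smul_eq_mul]
        push_cast
        field_simp
        ring
    rw [← hΦ, S18.entry Φ A ⟨_, hmem⟩ rfl]
    refine Z.add_mem (Z.smul_mem _ ?_) (Z.smul_mem _ ?_)
    · exact hrange ⟨x, rfl⟩
    · exact hrange (h.range_mem ⟨_, hmem⟩ x)
  · intro A A₀ hA
    have hoff : ∀ i i', S18.lam t i ≠ 2 - S18.lam t i' →
      (inner ℂ (S18.vec u2 u1 v w i) (Φ (S18.incl _ A₀) (S18.vec u2 u1 v w i')) : ℂ) = 0 :=
      fun i i' hne => h.orth (S18.vec_eig h2 h1 hv hw i)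
        (h.eig A₀ (S18.vec_eig h2 h1 hv hw i')) hne
    have hent : ∀ i i', (inner ℂ (S18.vec u2 u1 v w i) (φ A (S18.vec u2 u1 v w i')) : ℂ) =
        (A : Mat (2 * k)).trace / k / 2 * (S18.lam t i' * if i = i' then 1 else 0) + 2⁻¹ *
        inner ℂ (S18.vec u2 u1 v w i) (Φ (S18.incl _ A₀) (S18.vec u2 u1 v w i')) := by
      intro i i'
      rw [← hΦ, S18.entry Φ A A₀ hA, inner_add_right, inner_smul_right, inner_smul_right,
        ← hC, S18.vec_eig h2 h1 hv hw i', inner_smul_right, orthonormal_iff_ite.mp hon]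
    have hsq : ∀ j, ((Real.sqrt (t j * (1 - t j)) : ℝ) : ℂ) *
        (((2 * Real.sqrt (t j * (1 - t j)))⁻¹ : ℝ) : ℂ) = 2⁻¹ := by
      intro j
      have hpos : 0 < t j * (1 - t j) := mul_pos (by linarith [ht j]) (by linarith [ht j])
      have hs0 : Real.sqrt (t j * (1 - t j)) ≠ 0 := (Real.sqrt_pos.mpr hpos).ne'
      rw [← Complex.ofReal_mul, mul_inv, mul_comm (2⁻¹ : ℝ), ← mul_assoc, mul_inv_cancel₀ hs0]
      simp
    ext i i'
    obtain ⟨i, rfl⟩ := E.surjective i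
    obtain ⟨i', rfl⟩ := E.surjective i'
    rw [hE]
    show (inner ℂ (b (E i) : K) (φ A (b (E i') : K)) : ℂ) = _
    rw [hb, hb]
    have hz : ∀ i i', i ≠ i' → S18.lam t i ≠ 2 - S18.lam t i' →
        (inner ℂ (S18.vec u2 u1 v w i) (φ A (S18.vec u2 u1 v w i')) : ℂ) = 0 := by
      intro i i' hne hl
      rw [hent, hoff i i' hl, if_neg hne]
      simp
    have hd : ∀ i i', S18.lam t i ≠ 2 - S18.lam t i' →
        (inner ℂ (S18.vec u2 u1 v w i) (φ A (S18.vec u2 u1 v w i')) : ℂ) =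
        (A : Mat (2 * k)).trace / k / 2 * (S18.lam t i' * if i = i' then 1 else 0) := by
      intro i i' hl
      rw [hent, hoff i i' hl]
      simp
    generalize (A : Mat (2 * k)).trace / k = τ at *
    have hblk : ∀ j j' (a : Fin (mj j)) (c : Fin (mj j')),
        (inner ℂ (w j a) (φ A (v j' c)) : ℂ) =
          2⁻¹ * inner ℂ (w j a) (Φ (S18.incl _ A₀) (v j' c)) := by
      intro j j' a c
      have := hent (Sum.inr ⟨j, Sum.inr a⟩) (Sum.inr ⟨j', Sum.inl c⟩)
      rw [if_neg (by
        intro hh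
        have hh' := Sum.inr_injective hh
        by_cases hj : j = j'
        · subst hj; simp at hh'
        · exact hj (congrArg Sigma.fst hh')), mul_zero, mul_zero, zero_add] at this
      exact this
    rcases i with (a | a) | ⟨j, a | a⟩ <;> rcases i' with (c | c) | ⟨j', c | c⟩
    · rw [hd _ _ (by norm_num [S18.lam])]
      simp [S18.lam, Matrix.one_apply]
    · rw [hz _ _ (by simp) (by norm_num [S18.lam])]; simp
    · rw [hz _ _ (by simp) (by
        simp only [S18.lam, Sum.elim_inl, Sum.elim_inr]; intro hh; linarith [ht j'])]; simp
    · rw [hz _ _ (by simp) (by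
        simp only [S18.lam, Sum.elim_inl, Sum.elim_inr]; intro hh; linarith [ht j'])]; simp
    · rw [hz _ _ (by simp) (by norm_num [S18.lam])]; simp
    · rfl
    · rw [hz _ _ (by simp) (by
        simp only [S18.lam, Sum.elim_inl, Sum.elim_inr]; intro hh; linarith [ht j'])]; simp
    · rw [hz _ _ (by simp) (by
        simp only [S18.lam, Sum.elim_inl, Sum.elim_inr]; intro hh; linarith [ht j'])]; simp
    · rw [hz _ _ (by simp) (by
        simp only [S18.lam, Sum.elim_inl, Sum.elim_inr]; intro hh; linarith [ht j])]; simp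
    · rw [hz _ _ (by simp) (by
        simp only [S18.lam, Sum.elim_inl, Sum.elim_inr]; intro hh; linarith [ht j])]; simp
    · have hl : 2 * t j ≠ 2 - 2 * t j' := by intro hh; linarith [ht j, ht j']
      by_cases hj : j = j'
      · subst hj
        rw [hd _ _ (by exact hl)]
        simp only [S18.lam, Sum.elim_inl, Sum.elim_inr, Matrix.fromBlocks_apply₂₂,
          Matrix.blockDiagonal'_apply_eq, Matrix.fromBlocks_apply₁₁, Matrix.smul_apply,
          Matrix.one_apply, smul_eq_mul, Sum.inr.injEq, Sigma.mk.injEq, heq_eq_eq, true_and,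
          Sum.inl.injEq]
        push_cast
        split_ifs <;> ring
      · rw [hz _ _ (by intro hh; exact hj (congrArg Sigma.fst (Sum.inr_injective hh))) (by exact hl),
          Matrix.fromBlocks_apply₂₂, Matrix.blockDiagonal'_apply_ne _ _ _ hj]
    · by_cases hj : j = j'
      · subst hj
        have e1 : (inner ℂ (v j a) (φ A (w j c)) : ℂ) = star (inner ℂ (w j c) (φ A (v j a)) : ℂ) := by
          rw [← hsa]; exact (inner_conj_symm _ _).symm
        show (inner ℂ (v j a) (φ A (w j c)) : ℂ) = _
        rw [e1, hblk, Matrix.fromBlocks_apply₂₂, Matrix.blockDiagonal'_apply_eq,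
          Matrix.fromBlocks_apply₁₂, Matrix.smul_apply, Matrix.conjTranspose_apply]
        beta_reduce
        rw [
          Matrix.smul_apply, ← Complex.coe_smul, smul_eq_mul, smul_eq_mul, star_mul', star_mul',
          ← mul_assoc]
        congr 1
        rw [← hsq j]
        simp
      · have hl : 2 * t j ≠ 2 - (2 - 2 * t j') := by
          intro hh; exact hj (hmono.injective (by linarith))
        rw [hz _ _ (by intro hh; exact hj (congrArg Sigma.fst (Sum.inr_injective hh))) (by exact hl),
          Matrix.fromBlocks_apply₂₂, Matrix.blockDiagonal'_apply_ne _ _ _ hj]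
    · rw [hz _ _ (by simp) (by
        simp only [S18.lam, Sum.elim_inl, Sum.elim_inr]; intro hh; linarith [ht j])]; simp
    · rw [hz _ _ (by simp) (by
        simp only [S18.lam, Sum.elim_inl, Sum.elim_inr]; intro hh; linarith [ht j])]; simp
    · by_cases hj : j = j'
      · subst hj
        show (inner ℂ (w j a) (φ A (v j c)) : ℂ) = _
        rw [hblk, Matrix.fromBlocks_apply₂₂, Matrix.blockDiagonal'_apply_eq,
          Matrix.fromBlocks_apply₂₁, Matrix.smul_apply]
        beta_reduce
        rw [
          Matrix.smul_apply, ← Complex.coe_smul, smul_eq_mul, smul_eq_mul, ← mul_assoc, hsq j]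
        rfl
      · have hl : 2 - 2 * t j ≠ 2 - 2 * t j' := by
          intro hh; exact hj (hmono.injective (by linarith))
        rw [hz _ _ (by intro hh; exact hj (congrArg Sigma.fst (Sum.inr_injective hh))) (by exact hl),
          Matrix.fromBlocks_apply₂₂, Matrix.blockDiagonal'_apply_ne _ _ _ hj]
    · have hl : 2 - 2 * t j ≠ 2 - (2 - 2 * t j') := by intro hh; linarith [ht j, ht j']
      by_cases hj : j = j'
      · subst hj
        rw [hd _ _ (by exact hl)]
        simp only [S18.lam, Sum.elim_inr, Matrix.fromBlocks_apply₂₂,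
          Matrix.blockDiagonal'_apply_eq, Matrix.smul_apply,
          Matrix.one_apply, smul_eq_mul, Sum.inr.injEq, Sigma.mk.injEq, heq_eq_eq, true_and]
        push_cast
        split_ifs <;> ring
      · rw [hz _ _ (by intro hh; exact hj (congrArg Sigma.fst (Sum.inr_injective hh))) (by exact hl),
          Matrix.fromBlocks_apply₂₂, Matrix.blockDiagonal'_apply_ne _ _ _ hj]
end
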